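/- If an equation system S contains a variable X with X ≻⁺ X (i.e., (X,X) lies in the transitive closure of the relation ≻), then S has no E₀-unifier. -/

import Mathlib

/-- Terms built from variables, free constants, two multiplication symbols
`mul` (*) and `cmul` (⊛), a binary symbol `exp`, and a unary symbol `g`. -/
inductive Tm : Type
  | var : ℕ → Tm
  | const : ℕ → Tm
  | mul : Tm → Tm → Tm
  | cmul : Tm → Tm → Tm
  | exp : Tm → Tm → Tm
  | g : Tm → Tm

/-- The equational theory E₀: the smallest congruence on terms, closed under
substitution (hence the axioms are stated for arbitrary terms), generated by
`exp(g(X),Y) = g(X ⊛ Y)` and `exp(X*Y,Z) = exp(X,Z) * exp(Y,Z)`. -/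
inductive E0 : Tm → Tm → Prop
  | ax1 (x y : Tm) : E0 (.exp (.g x) y) (.g (.cmul x y))
  | ax2 (x y z : Tm) : E0 (.exp (.mul x y) z) (.mul (.exp x z) (.exp y z))
  | refl (t : Tm) : E0 t t
  | symm {s t : Tm} : E0 s t → E0 t s
  | trans {s t u : Tm} : E0 s t → E0 t u → E0 s u
  | mul_congr {a b c d : Tm} : E0 a b → E0 c d → E0 (.mul a c) (.mul b d)
  | cmul_congr {a b c d : Tm} : E0 a b → E0 c d → E0 (.cmul a c) (.cmul b d)
  | exp_congr {a b c d : Tm} : E0 a b → E0 c d → E0 (.exp a c) (.exp b d)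
  | g_congr {a b : Tm} : E0 a b → E0 (.g a) (.g b)

/-- A ground term contains no variables. -/
def Tm.Ground : Tm → Prop
  | .var _ => False
  | .const _ => True
  | .mul s t => s.Ground ∧ t.Ground
  | .cmul s t => s.Ground ∧ t.Ground
  | .exp s t => s.Ground ∧ t.Ground
  | .g t => t.Ground


/-- Flat right-hand sides of equations: a variable, or `g(V)`, `exp(V,W)`,
`V*W`, `V⊛W` with `V`, `W` variables. -/
inductive Flat : Type
  | var : ℕ → Flat
  | g : ℕ → Flat
  | exp : ℕ → ℕ → Flat
  | mul : ℕ → ℕ → Flat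
  | cmul : ℕ → ℕ → Flat
deriving DecidableEq

/-- An equation `U =? t` is a pair of a variable and a flat term. -/
abbrev Eqn : Type := ℕ × Flat

/-- An equation system is a finite set of equations. -/
abbrev Sys : Type := Finset Eqn

/-- Interpretation of a flat term under a substitution. -/
def Flat.toTm (σ : ℕ → Tm) : Flat → Tm
  | .var v => σ v
  | .g v => .g (σ v)
  | .exp v w => .exp (σ v) (σ w)
  | .mul v w => .mul (σ v) (σ w)
  | .cmul v w => .cmul (σ v) (σ w)

/-- `σ` is an E₀-unifier of `S` iff `σ(U) =_{E₀} σ(t)` for each `U =? t` in `S`. -/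
def IsUnifier (σ : ℕ → Tm) (S : Sys) : Prop :=
  ∀ e ∈ S, E0 (σ e.1) (Flat.toTm σ e.2)

/-- The variables occurring in a flat term. -/
def Flat.vars : Flat → Finset ℕ
  | .var v => {v}
  | .g v => {v}
  | .exp v w => {v, w}
  | .mul v w => {v, w}
  | .cmul v w => {v, w}

/-- A flat term is a non-variable term. -/
def Flat.NonVar : Flat → Prop
  | .var _ => False
  | _ => True

/-- `U ≻ V` iff `S` contains an equation `U =? t` with `t` a non-variable term
containing `V`. -/
def Succ (S : Sys) (U V : ℕ) : Prop :=
  ∃ t : Flat, (U, t) ∈ S ∧ t.NonVar ∧ V ∈ t.vars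

/-- `U ≻_b V` iff `S` contains an equation `U =? exp(V,W)`. -/
def SuccB (S : Sys) (U V : ℕ) : Prop :=
  ∃ W, (U, Flat.exp V W) ∈ S

/-- `U ≻_m V` iff `S` contains an equation `U =? V*W` or `U =? W*V`. -/
def SuccM (S : Sys) (U V : ℕ) : Prop :=
  ∃ W, (U, Flat.mul V W) ∈ S ∨ (U, Flat.mul W V) ∈ S

/-- `∼` is the reflexive-symmetric-transitive closure of `≻_b`. -/
def Sim (S : Sys) : ℕ → ℕ → Prop :=
  Relation.EqvGen (SuccB S)

/-- A weight on terms that is invariant under E₀ and exceeds the weights of all proper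
subterms. -/
def Tm.weight : Tm → ℕ
  | .var _ => 0
  | .const _ => 0
  | .mul s t => max s.weight t.weight + 1
  | .cmul s t => s.weight + t.weight + 1
  | .exp s t => s.weight + t.weight + 1
  | .g t => t.weight + 1

theorem E0.weight_eq {s t : Tm} (h : E0 s t) : s.weight = t.weight := by
  induction h <;> grind [Tm.weight]

theorem IsUnifier.weight_lt_of_succ {σ : ℕ → Tm} {S : Sys} (hσ : IsUnifier σ S) {U V : ℕ}
    (h : Succ S U V) : (σ V).weight < (σ U).weight := by
  obtain ⟨t, ht, hn, hV⟩ := h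
  rw [(hσ _ ht).weight_eq]
  cases t <;> simp only [Flat.NonVar, Flat.vars, Finset.mem_insert, Finset.mem_singleton] at hn hV
  · subst hV
    simp [Flat.toTm, Tm.weight]
  all_goals
    rcases hV with rfl | rfl <;> simp only [Flat.toTm, Tm.weight] <;> omega

/-- If an equation system `S` contains a variable `X` with `X ≻⁺ X`, then `S`
has no E₀-unifier. -/
theorem no_unifier_of_succ_cycle (S : Sys) (X : ℕ)
    (h : Relation.TransGen (Succ S) X X) : ¬ ∃ σ : ℕ → Tm, IsUnifier σ S := by
  rintro ⟨σ, hσ⟩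
  have key : ∀ {V : ℕ}, Relation.TransGen (Succ S) X V → (σ V).weight < (σ X).weight := by
    intro V hV
    induction hV with
    | single h => exact hσ.weight_lt_of_succ h
    | tail _ h ih => exact (hσ.weight_lt_of_succ h).trans ih
  exact lt_irrefl _ (key h)
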